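/- arXiv:2604.22510 — 2 statements merged into one kernel-verified Lean document; each statement's English description precedes it below -/
import Mathlib

section
/- Let (Ω, 𝓕, ℙ) be a probability space, T > 0, p ≥ 2, and ξ ∈ L^p(Ω; ℝⁿ). Let b̄: ℝⁿ × 𝒫₂(ℝⁿ) → ℝⁿ be measurable and suppose there is C₀ > 0 with ⟨b̄(x,μ), x⟩ ≤ C₀(1 + |x|² + M₂(μ)) for all x ∈ ℝⁿ and μ ∈ 𝒫₂(ℝⁿ). Let X̄: Ω × [0,T] → ℝⁿ be a measurable process with X̄₀ = ξ, whose paths are absolutely continuous with dX̄_t/dt = b̄(X̄_t, 𝓛_{X̄_t}) for almost every t ∈ [0,T], where 𝓛_{X̄_t} denotes the law of X̄_t, and assume E[sup_{t∈[0,T]} |X̄_t|^p] < ∞. Then E[sup_{t∈[0,T]} |X̄_t|^p] ≤ C (1 + E|ξ|^p) for a constant C depending only on p, T and C₀. -/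
open MeasureTheory
open scoped RealInnerProductSpace

noncomputable section

/-- `ℝ^n` with the Euclidean norm. -/
abbrev Euc (n : ℕ) : Type := EuclideanSpace ℝ (Fin n)

/-- Differential Grönwall inequality for an absolutely continuous function. -/
theorem AbsolutelyContinuousOnInterval.le_exp_mul_of_ae_hasDerivAt {φ h : ℝ → ℝ} {K T : ℝ}
    (hK : 0 ≤ K) (hφ : AbsolutelyContinuousOnInterval φ 0 T)
    (hderiv : ∀ᵐ x, x ∈ Set.Icc 0 T → ∃ d, HasDerivAt φ d x ∧ d ≤ K * φ x + h x)
    (hh : IntervalIntegrable h volume 0 T) (h_nonneg : ∀ x ∈ Set.Icc 0 T, 0 ≤ h x)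
    {t : ℝ} (ht : t ∈ Set.Icc 0 T) :
    φ t ≤ Real.exp (K * t) * (φ 0 + ∫ s in (0 : ℝ)..t, h s) := by
  have hT : 0 ≤ T := ht.1.trans ht.2
  have hsub : Set.uIcc 0 t ⊆ Set.uIcc 0 T := by
    rw [Set.uIcc_of_le ht.1, Set.uIcc_of_le hT]
    exact Set.Icc_subset_Icc_right ht.2
  have hexp : AbsolutelyContinuousOnInterval (fun x => Real.exp (-(K * x))) 0 t := by
    apply ContDiffOn.absolutelyContinuousOnInterval
    fun_prop
  have hψ := hexp.fun_mul (hφ.mono hsub)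
  have hle : ∫ x in (0 : ℝ)..t, deriv (fun x => Real.exp (-(K * x)) * φ x) x
      ≤ ∫ x in (0 : ℝ)..t, h x := by
    apply intervalIntegral.integral_mono_ae_restrict ht.1 hψ.intervalIntegrable_deriv
      (hh.mono_set hsub)
    rw [Filter.EventuallyLE, ae_restrict_iff' measurableSet_Icc]
    filter_upwards [hderiv] with x hx hxt
    have hxT : x ∈ Set.Icc 0 T := ⟨hxt.1, hxt.2.trans ht.2⟩
    obtain ⟨d, hd, hle⟩ := hx hxT
    have he : HasDerivAt (fun x => Real.exp (-(K * x))) (Real.exp (-(K * x)) * (-K)) x := by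
      have := ((hasDerivAt_id x).const_mul K).neg.exp
      simpa using this
    have hprod : HasDerivAt (fun x => Real.exp (-(K * x)) * φ x) _ x := he.mul hd
    rw [hprod.deriv]
    have h1 : Real.exp (-(K * x)) ≤ 1 := by
      rw [Real.exp_le_one_iff]
      nlinarith [hxt.1]
    nlinarith [Real.exp_pos (-(K * x)), h_nonneg x hxT,
      mul_nonneg (Real.exp_pos (-(K * x))).le (sub_nonneg.2 hle),
      mul_nonneg (sub_nonneg.2 h1) (h_nonneg x hxT)]
  rw [hψ.integral_deriv_eq_sub] at hle
  simp only [mul_zero, neg_zero, Real.exp_zero, one_mul] at hle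
  rw [Real.exp_neg] at hle
  have hpos := Real.exp_pos (K * t)
  have : (Real.exp (K * t))⁻¹ * φ t ≤ φ 0 + ∫ s in (0 : ℝ)..t, h s := by linarith
  rwa [inv_mul_le_iff₀ hpos] at this

/-- The squared norm of an integral function is absolutely continuous. -/
theorem absolutelyContinuousOnInterval_norm_sq_integral {n : ℕ} {g : ℝ → Euc n} {T : ℝ}
    (hg : IntervalIntegrable g volume 0 T) (y : Euc n) :
    AbsolutelyContinuousOnInterval (fun t => ‖y + ∫ s in (0 : ℝ)..t, g s‖ ^ 2) 0 T := by
  have hcoord : ∀ i, AbsolutelyContinuousOnInterval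
      (fun t => y i + ∫ s in (0 : ℝ)..t, g s i) 0 T := fun i =>
    (LipschitzWith.const (y i)).lipschitzOnWith.absolutelyContinuousOnInterval.fun_add
      (IntervalIntegrable.absolutelyContinuousOnInterval_intervalIntegral
        ⟨(EuclideanSpace.proj (𝕜 := ℝ) i).integrable_comp hg.1,
          (EuclideanSpace.proj (𝕜 := ℝ) i).integrable_comp hg.2⟩ Set.left_mem_uIcc)
  have hsum : ∀ s : Finset (Fin n), AbsolutelyContinuousOnInterval
      (fun t => ∑ i ∈ s, (y i + ∫ s in (0 : ℝ)..t, g s i) *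
        (y i + ∫ s in (0 : ℝ)..t, g s i)) 0 T := by
    classical
    intro s
    induction s using Finset.induction_on with
    | empty =>
      simpa using (LipschitzWith.const (0 : ℝ)).lipschitzOnWith.absolutelyContinuousOnInterval
    | insert i s hi ih =>
      simp only [Finset.sum_insert hi]
      exact ((hcoord i).fun_mul (hcoord i)).fun_add ih
  have heq : ∀ t ∈ Set.uIcc 0 T, ∀ i,
      (∫ s in (0 : ℝ)..t, g s) i = ∫ s in (0 : ℝ)..t, g s i := fun t ht i =>
    ((EuclideanSpace.proj (𝕜 := ℝ) i).intervalIntegral_comp_comm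
      (hg.mono_set (Set.uIcc_subset_uIcc_left ht))).symm
  refine Filter.Tendsto.congr' ?_ (hsum Finset.univ)
  filter_upwards [Filter.mem_inf_of_right (Filter.mem_principal_self _)] with E hE
  refine Finset.sum_congr rfl fun k hk => ?_
  have hval : ∀ t ∈ Set.uIcc 0 T, ∑ i, (y i + ∫ s in (0 : ℝ)..t, g s i) *
        (y i + ∫ s in (0 : ℝ)..t, g s i) = ‖y + ∫ s in (0 : ℝ)..t, g s‖ ^ 2 := by
    intro t ht
    rw [EuclideanSpace.norm_sq_eq]
    refine Finset.sum_congr rfl fun i _ => ?_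
    rw [PiLp.add_apply, heq t ht, Real.norm_eq_abs, sq_abs, sq]
  have hmem := hE.1 k hk
  rw [hval _ hmem.1, hval _ hmem.2]

/-- Energy estimate for an integral curve whose velocity satisfies a one-sided growth bound. -/
theorem norm_sq_le_of_inner_le {n : ℕ} {g x : ℝ → Euc n} {y : Euc n} {h : ℝ → ℝ} {K T : ℝ}
    (hK : 0 ≤ K) (hg : IntervalIntegrable g volume 0 T)
    (hx : ∀ t ∈ Set.Icc 0 T, x t = y + ∫ s in (0 : ℝ)..t, g s)
    (hinner : ∀ t ∈ Set.Icc 0 T, 2 * ⟪g t, x t⟫ ≤ K * ‖x t‖ ^ 2 + h t)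
    (hh : IntervalIntegrable h volume 0 T) (h_nonneg : ∀ t ∈ Set.Icc 0 T, 0 ≤ h t)
    {t : ℝ} (ht : t ∈ Set.Icc 0 T) :
    ‖x t‖ ^ 2 ≤ Real.exp (K * t) * (‖y‖ ^ 2 + ∫ s in (0 : ℝ)..t, h s) := by
  have hT : 0 ≤ T := ht.1.trans ht.2
  have := (absolutelyContinuousOnInterval_norm_sq_integral hg y).le_exp_mul_of_ae_hasDerivAt
    hK (h := h) ?_ hh h_nonneg ht
  · simpa [← hx t ht] using this
  · filter_upwards [hg.ae_hasDerivAt_integral] with s hs hsT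
    have hd := ((hs (by rwa [Set.uIcc_of_le hT]) 0 Set.left_mem_uIcc).const_add y).norm_sq
    refine ⟨_, hd, ?_⟩
    rw [← hx s hsT, real_inner_comm]
    exact hinner s hsT

/-- Grönwall inequality in integral form. -/
theorem le_of_le_add_mul_integral {m : ℝ → ℝ} {A B T : ℝ} (hA : 0 ≤ A) (hB : 0 ≤ B)
    (hm : IntervalIntegrable m volume 0 T)
    (hle : ∀ t ∈ Set.Icc 0 T, m t ≤ A + B * ∫ s in (0 : ℝ)..t, m s)
    {t : ℝ} (ht : t ∈ Set.Icc 0 T) :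
    m t ≤ A + B * (Real.exp (B * T) * (T * A)) := by
  have hT : 0 ≤ T := ht.1.trans ht.2
  have hac := hm.absolutelyContinuousOnInterval_intervalIntegral Set.left_mem_uIcc
  have hbound := hac.le_exp_mul_of_ae_hasDerivAt hB (h := fun _ => A) ?_
    intervalIntegrable_const (fun _ _ => hA) ht
  · refine (hle t ht).trans ?_
    simp only [intervalIntegral.integral_same, zero_add, intervalIntegral.integral_const,
      sub_zero, smul_eq_mul] at hbound
    gcongr
    refine hbound.trans ?_
    gcongr
    exacts [mul_nonneg ht.1 hA, ht.2, ht.2]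
  · filter_upwards [hm.ae_hasDerivAt_integral] with s hs hsT
    refine ⟨_, hs (by rwa [Set.uIcc_of_le hT]) 0 Set.left_mem_uIcc, ?_⟩
    linarith [hle s hsT]

theorem Real.sq_rpow_half {x : ℝ} (hx : 0 ≤ x) (p : ℝ) : (x ^ 2) ^ (p / 2) = x ^ p := by
  rw [← Real.rpow_natCast, ← Real.rpow_mul hx]
  congr 1
  push_cast
  ring

/-- Jensen's inequality for the second and `p`-th moments of a norm. -/
theorem integral_norm_sq_rpow_le {Ω E : Type*} [MeasurableSpace Ω] [NormedAddCommGroup E]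
    {P : Measure Ω} [IsProbabilityMeasure P] {ξ : Ω → E} {p : ℝ} (hp : 2 ≤ p)
    (h2 : Integrable (fun ω => ‖ξ ω‖ ^ 2) P) (hξ : Integrable (fun ω => ‖ξ ω‖ ^ p) P) :
    (∫ ω, ‖ξ ω‖ ^ 2 ∂P) ^ (p / 2) ≤ ∫ ω, ‖ξ ω‖ ^ p ∂P := by
  have hpow : ∀ ω, (‖ξ ω‖ ^ 2) ^ (p / 2) = ‖ξ ω‖ ^ p := fun ω =>
    Real.sq_rpow_half (norm_nonneg _) p
  have := (convexOn_rpow (p := p / 2) (by linarith)).map_integral_le (μ := P)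
    (f := fun ω => ‖ξ ω‖ ^ 2)
    (Real.continuous_rpow_const (by linarith : 0 ≤ p / 2)).continuousOn isClosed_Ici
    (Filter.Eventually.of_forall fun ω => sq_nonneg ‖ξ ω‖) h2
    (by simpa only [Function.comp_def, hpow] using hξ)
  simpa only [hpow] using this

theorem Real.add_add_rpow_le {a b c q : ℝ} (ha : 0 ≤ a) (hb : 0 ≤ b) (hc : 0 ≤ c) (hq : 0 ≤ q) :
    (a + b + c) ^ q ≤ 3 ^ q * (a ^ q + b ^ q + c ^ q) := by
  have key : ∀ x, 0 ≤ x → a + b + c ≤ 3 * x → (a + b + c) ^ q ≤ 3 ^ q * x ^ q := by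
    intro x hx h
    rw [← Real.mul_rpow (by norm_num) hx]
    exact Real.rpow_le_rpow (by positivity) h hq
  have h3 : (0 : ℝ) ≤ 3 ^ q := by positivity
  have pa := mul_nonneg h3 (Real.rpow_nonneg ha q)
  have pb := mul_nonneg h3 (Real.rpow_nonneg hb q)
  have pc := mul_nonneg h3 (Real.rpow_nonneg hc q)
  rcases le_total a b with h1 | h1 <;> rcases le_total b c with h2 | h2 <;>
    rcases le_total a c with h4 | h4 <;>
    first
    | linarith [key a ha (by linarith)]
    | linarith [key b hb (by linarith)]
    | linarith [key c hc (by linarith)]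

theorem Real.sq_le_one_add_rpow {x p : ℝ} (hx : 0 ≤ x) (hp : 2 ≤ p) : x ^ 2 ≤ 1 + x ^ p := by
  rcases le_total x 1 with h | h
  · nlinarith [Real.rpow_nonneg hx p]
  · have := Real.rpow_le_rpow_of_exponent_le h hp
    rw [Real.rpow_two] at this
    linarith

theorem Real.rpow_le_of_sq_le {s x D M p : ℝ} (hs : 0 ≤ s) (hx : 0 ≤ x) (hD : 0 ≤ D) (hM : 0 ≤ M)
    (hp : 0 ≤ p) (h : s ^ 2 ≤ D * (x ^ 2 + 1 + M)) :
    s ^ p ≤ D ^ (p / 2) * 3 ^ (p / 2) * (x ^ p + 1 + M ^ (p / 2)) := by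
  calc s ^ p = (s ^ 2) ^ (p / 2) := (Real.sq_rpow_half hs p).symm
    _ ≤ (D * (x ^ 2 + 1 + M)) ^ (p / 2) := Real.rpow_le_rpow (sq_nonneg s) h (by linarith)
    _ = D ^ (p / 2) * (x ^ 2 + 1 + M) ^ (p / 2) := Real.mul_rpow hD (by positivity)
    _ ≤ D ^ (p / 2) * (3 ^ (p / 2) * ((x ^ 2) ^ (p / 2) + 1 ^ (p / 2) + M ^ (p / 2))) := by
      gcongr
      exact Real.add_add_rpow_le (sq_nonneg _) zero_le_one hM (by linarith)
    _ = _ := by rw [Real.sq_rpow_half hx, Real.one_rpow]; ring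

theorem mul_add_le_mul_add_one_add {a c K T M x : ℝ} (ha : 0 ≤ a) (hc : 0 ≤ c) (hK : 0 ≤ K)
    (hT : 0 ≤ T) (hM : 0 ≤ M) (hx : 0 ≤ x) :
    a * (x + K * (T + T * (c * (a * (M + K * T))))) ≤
      a * (1 + K * T * (1 + c * a * (1 + K * T))) * (x + 1 + M) := by
  rw [mul_assoc a (1 + _)]
  refine mul_le_mul_of_nonneg_left (sub_nonneg.1 ?_) ha
  ring_nf
  positivity

/-- moment estimate for the averaged McKean--Vlasov ODE
`dX̄_t/dt = b̄(X̄_t, 𝓛_{X̄_t})`, `X̄₀ = ξ`, under the coercivity condition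
`⟨b̄(x,μ), x⟩ ≤ C₀(1 + |x|² + M₂(μ))`:
`E[sup_{t∈[0,T]} |X̄_t|^p] ≤ C (1 + E|ξ|^p)` with `C = C(p, T, C₀)`. -/
theorem averaged_equation_moment_bound (n : ℕ) (p T C0 : ℝ) (hp : 2 ≤ p) (hT : 0 < T)
    (hC0 : 0 < C0) :
    ∃ C > 0, ∀ (Ω : Type) [MeasurableSpace Ω] (P : Measure Ω), IsProbabilityMeasure P →
      ∀ bbar : Euc n → Measure (Euc n) → Euc n,
        (∀ (x : Euc n) (μ : Measure (Euc n)), IsProbabilityMeasure μ →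
          Integrable (fun z => ‖z‖ ^ 2) μ →
          ⟪bbar x μ, x⟫ ≤ C0 * (1 + ‖x‖ ^ 2 + ∫ z, ‖z‖ ^ 2 ∂μ)) →
      ∀ (ξ : Ω → Euc n) (X : Ω → ℝ → Euc n),
        Integrable (fun ω => ‖ξ ω‖ ^ p) P →
        (∀ t, Measurable fun ω => X ω t) →
        (∀ ω, X ω 0 = ξ ω) →
        (∀ ω, IntervalIntegrable
          (fun s => bbar (X ω s) (P.map fun ω' => X ω' s)) volume 0 T) →
        (∀ ω, ∀ t ∈ Set.Icc (0 : ℝ) T,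
          X ω t = ξ ω + ∫ s in (0 : ℝ)..t, bbar (X ω s) (P.map fun ω' => X ω' s)) →
        Integrable (fun ω => (⨆ t : Set.Icc (0 : ℝ) T, ‖X ω t.1‖) ^ p) P →
        (∫ ω, (⨆ t : Set.Icc (0 : ℝ) T, ‖X ω t.1‖) ^ p ∂P) ≤
          C * (1 + ∫ ω, ‖ξ ω‖ ^ p ∂P) := by
  set K := 2 * C0 with hK_def
  have hK : 0 < K := by positivity
  set a := Real.exp (K * T) with ha_def
  have ha : 0 < a := Real.exp_pos _
  set c := 1 + a * K * (Real.exp (a * K * T) * T) with hc_def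
  have hc : 0 < c := by positivity
  set D := a * (1 + K * T * (1 + c * a * (1 + K * T))) with hD_def
  have hD : 0 < D := by positivity
  refine ⟨2 * (D ^ (p / 2) * 3 ^ (p / 2)), by positivity, ?_⟩
  intro Ω _ P hP bbar hb ξ X hξ hXmeas hX0 hgint hX hSint
  set S : Ω → ℝ := fun ω => ⨆ t : Set.Icc (0 : ℝ) T, ‖X ω t.1‖ with hS_def
  have hcont : ∀ ω, ContinuousOn (X ω) (Set.Icc 0 T) := by
    intro ω
    have : ContinuousOn (fun t => ξ ω + ∫ s in (0 : ℝ)..t,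
        bbar (X ω s) (P.map fun ω' => X ω' s)) (Set.Icc 0 T) := by
      refine continuousOn_const.add ?_
      have := intervalIntegral.continuousOn_primitive_interval' (hgint ω) Set.left_mem_uIcc
      rwa [Set.uIcc_of_le hT.le] at this
    exact this.congr (hX ω)
  have hle_S : ∀ ω, ∀ t ∈ Set.Icc 0 T, ‖X ω t‖ ≤ S ω := by
    intro ω t ht
    refine le_ciSup (f := fun t : Set.Icc (0 : ℝ) T => ‖X ω t.1‖) ?_ ⟨t, ht⟩
    have := isCompact_Icc.bddAbove_image (hcont ω).norm
    rwa [Set.image_eq_range] at this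
  have h0 : (0 : ℝ) ∈ Set.Icc 0 T := ⟨le_rfl, hT.le⟩
  have hS0 : ∀ ω, 0 ≤ S ω := fun ω => (norm_nonneg _).trans (hle_S ω 0 h0)
  have hdom : ∀ ω, ∀ t ∈ Set.Icc 0 T, ‖X ω t‖ ^ 2 ≤ 1 + S ω ^ p := fun ω t ht =>
    (pow_le_pow_left₀ (norm_nonneg _) (hle_S ω t ht) 2).trans (Real.sq_le_one_add_rpow (hS0 ω) hp)
  have hdom_int : Integrable (fun ω => 1 + S ω ^ p) P := (integrable_const 1).add hSint
  have hX2meas : ∀ t, AEStronglyMeasurable (fun ω => ‖X ω t‖ ^ 2) P := fun t =>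
    ((hXmeas t).norm.pow_const 2).aestronglyMeasurable
  have hX2int : ∀ t ∈ Set.Icc 0 T, Integrable (fun ω => ‖X ω t‖ ^ 2) P := fun t ht =>
    hdom_int.mono' (hX2meas t) (Filter.Eventually.of_forall fun ω => by
      simpa using hdom ω t ht)
  set m : ℝ → ℝ := fun t => ∫ ω, ‖X ω t‖ ^ 2 ∂P with hm_def
  have hm0 : ∀ t, 0 ≤ m t := fun t => integral_nonneg fun ω => sq_nonneg _
  have hmcont : ContinuousOn m (Set.Icc 0 T) :=
    continuousOn_of_dominated (fun t _ => hX2meas t)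
      (fun t ht => Filter.Eventually.of_forall fun ω => by simpa using hdom ω t ht) hdom_int
      (Filter.Eventually.of_forall fun ω => (hcont ω).norm.pow 2)
  have hmint : ∀ t ∈ Set.Icc 0 T, IntervalIntegrable m volume 0 t := fun t ht =>
    ContinuousOn.intervalIntegrable_of_Icc ht.1 (hmcont.mono (Set.Icc_subset_Icc_right ht.2))
  have hTT : T ∈ Set.Icc 0 T := ⟨hT.le, le_rfl⟩
  have hint_h : ∀ t ∈ Set.Icc 0 T,
      ∫ s in (0 : ℝ)..t, K * (1 + m s) = K * (t + ∫ s in (0 : ℝ)..t, m s) := by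
    intro t ht
    rw [intervalIntegral.integral_const_mul,
      intervalIntegral.integral_add intervalIntegrable_const (hmint t ht)]
    simp
  have hpath : ∀ ω, ∀ t ∈ Set.Icc 0 T,
      ‖X ω t‖ ^ 2 ≤ a * (‖ξ ω‖ ^ 2 + K * (T + ∫ s in (0 : ℝ)..t, m s)) := by
    intro ω t ht
    have := norm_sq_le_of_inner_le (h := fun s => K * (1 + m s)) hK.le (hgint ω) (hX ω) ?_
      ((intervalIntegrable_const.add (hmint T hTT)).const_mul K)
      (fun s _ => mul_nonneg hK.le (by linarith [hm0 s])) ht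
    · rw [hint_h t ht] at this
      refine this.trans ?_
      have : 0 ≤ ∫ s in (0 : ℝ)..t, m s :=
        intervalIntegral.integral_nonneg ht.1 fun s _ => hm0 s
      have := ht.1
      rw [ha_def]
      gcongr
      exacts [ht.2, ht.2]
    · intro s hs
      have hlaw : AEMeasurable (fun ω' => X ω' s) P := (hXmeas s).aemeasurable
      have hsq : ∀ μ : Measure (Euc n), AEStronglyMeasurable (fun z : Euc n => ‖z‖ ^ 2) μ :=
        fun μ => (by fun_prop : Continuous fun z : Euc n => ‖z‖ ^ 2).aestronglyMeasurable
      have := hb (X ω s) (P.map fun ω' => X ω' s) (Measure.isProbabilityMeasure_map hlaw)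
        ((integrable_map_measure (hsq _) hlaw).2 (hX2int s hs))
      rw [integral_map hlaw (hsq _)] at this
      change _ ≤ C0 * (1 + _ + m s) at this
      rw [hK_def]
      linarith
  have hξ2 : Integrable (fun ω => ‖ξ ω‖ ^ 2) P := by
    simpa only [hX0] using hX2int 0 h0
  set M := ∫ ω, ‖ξ ω‖ ^ 2 ∂P with hM_def
  have hM : 0 ≤ M := integral_nonneg fun ω => sq_nonneg _
  have hm_le : ∀ t ∈ Set.Icc 0 T, m t ≤ c * (a * (M + K * T)) := by
    intro t ht
    have := le_of_le_add_mul_integral (A := a * (M + K * T)) (B := a * K) (by positivity)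
      (by positivity) (hmint T hTT) ?_ ht
    · refine this.trans_eq ?_
      rw [hc_def]
      ring
    · intro t ht
      have := integral_mono (hX2int t ht) ((hξ2.add (integrable_const _)).const_mul a)
        (fun ω => hpath ω t ht)
      refine this.trans_eq ?_
      rw [integral_const_mul]
      simp only [Pi.add_apply]
      rw [integral_add hξ2 (integrable_const _)]
      simp
      ring
  have hpath' : ∀ ω, ∀ t ∈ Set.Icc 0 T, ‖X ω t‖ ^ 2 ≤ D * (‖ξ ω‖ ^ 2 + 1 + M) := by
    intro ω t ht
    have hI : ∫ s in (0 : ℝ)..t, m s ≤ T * (c * (a * (M + K * T))) := by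
      have := intervalIntegral.integral_mono_on ht.1 (hmint t ht) intervalIntegrable_const
        (fun s hs => hm_le s ⟨hs.1, hs.2.trans ht.2⟩)
      refine this.trans ?_
      rw [intervalIntegral.integral_const, sub_zero, smul_eq_mul]
      gcongr
      exact ht.2
    calc ‖X ω t‖ ^ 2 ≤ a * (‖ξ ω‖ ^ 2 + K * (T + ∫ s in (0 : ℝ)..t, m s)) := hpath ω t ht
      _ ≤ a * (‖ξ ω‖ ^ 2 + K * (T + T * (c * (a * (M + K * T))))) := by gcongr
      _ ≤ D * (‖ξ ω‖ ^ 2 + 1 + M) :=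
        mul_add_le_mul_add_one_add ha.le hc.le hK.le hT.le hM (sq_nonneg _)
  have hSp : ∀ ω, S ω ^ p ≤ D ^ (p / 2) * 3 ^ (p / 2) * (‖ξ ω‖ ^ p + 1 + M ^ (p / 2)) := by
    intro ω
    refine Real.rpow_le_of_sq_le (hS0 ω) (norm_nonneg _) hD.le hM (by linarith) ?_
    have : Nonempty (Set.Icc (0 : ℝ) T) := ⟨⟨0, h0⟩⟩
    refine (Real.le_sqrt (hS0 ω) (by positivity)).1 ?_
    exact ciSup_le fun t => Real.le_sqrt_of_sq_le (hpath' ω t.1 t.2)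
  have hint1 : Integrable (fun ω => ‖ξ ω‖ ^ p + 1) P := hξ.add (integrable_const 1)
  have hfin := integral_mono hSint
    ((hint1.add (integrable_const (M ^ (p / 2)))).const_mul (D ^ (p / 2) * 3 ^ (p / 2))) hSp
  refine hfin.trans ?_
  have hJ := integral_norm_sq_rpow_le hp hξ2 hξ
  rw [integral_const_mul]
  simp only [Pi.add_apply]
  rw [integral_add hint1 (integrable_const _), integral_add hξ (integrable_const _)]
  simp only [integral_const, probReal_univ, smul_eq_mul, one_mul]
  rw [mul_comm (2 : ℝ), mul_assoc (_ * _) (2 : ℝ)]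
  exact mul_le_mul_of_nonneg_left (by linarith) (by positivity)
end
end

section
/- Let n, m, d₁, d₂ ∈ ℕ, d := d₁ + d₂, π₁: ℝ^d → ℝ^{d₁} the canonical projection onto the first d₁ coordinates, T > 0, x ∈ ℝⁿ, and K, B > 0. Let b̄: ℝⁿ × 𝒫₂(ℝⁿ) → ℝⁿ and σ: ℝⁿ × 𝒫₂(ℝⁿ) × ℝ^m × 𝒫₂(ℝ^m) → ℝ^{n×d₁} be measurable with |b̄(z,μ)|² ≤ B(1 + |z|² + M₂(μ)) and ‖σ(z,μ,y,ρ)‖² ≤ B(1 + |z|² + M₂(μ) + |y|² + M₂(ρ)) for all arguments. Let (μ_s)_{s∈[0,T]} ⊂ 𝒫₂(ℝⁿ) satisfy sup_{s∈[0,T]} M₂(μ_s) ≤ B, and let Π be a Borel measure on ℝ^d × ℝ^m × 𝒫₂(ℝ^m) × [0,T] whose marginal on [0,T] is Lebesgue measure and which satisfies ∫ (|h|² + |y|⁴ + M₄(ρ)) Π(dh, dy, dρ, ds) ≤ K. Suppose φ ∈ C([0,T]; ℝⁿ) satisfies, for every t ∈ [0,T], φ_t = x + ∫_{ℝ^d ×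 ℝ^m × 𝒫₂(ℝ^m) × [0,t]} [ b̄(φ_s, μ_s) + σ(φ_s, μ_s, y, ρ) π₁ h ] Π(dh, dy, dρ, ds). Then there exists a constant C, depending only on n, B, K, T and |x|, such that |φ_{t₂} − φ_{t₁}| ≤ C ((t₂ − t₁)^{1/2} + (t₂ − t₁)^{1/4}) for all 0 ≤ t₁ ≤ t₂ ≤ T; in particular, the collection of all such φ (for fixed x, B, K, T) is relatively compact in C([0,T]; ℝⁿ). -/
open MeasureTheory
open scoped BigOperators ENNReal

noncomputable section

/-- Hilbert–Schmidt (Frobenius) norm of a matrix. -/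
noncomputable def hsNorm {k l : ℕ} (A : Matrix (Fin k) (Fin l) ℝ) : ℝ :=
  Real.sqrt (∑ i, ∑ j, (A i j) ^ 2)

/-- A continuous path `φ` on `[0,T]`, starting at `x`, solving the controlled averaged
equation driven by an occupation measure `Π` on
`ℝ^{d₁+d₂} × ℝ^m × 𝒫₂(ℝ^m) × [0,T]` with time marginal the Lebesgue measure,
fourth-moment bound `K`, for some coefficients `b̄, σ` with growth constant `B` and a
family of measures `(μ_s)` with second moments bounded by `B`. -/
def ViablePath (n m d1 d2 : ℕ) (T B K : ℝ) (x : Euc n) (φ : ℝ → Euc n) : Prop :=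
  ∃ (bbar : Euc n → Measure (Euc n) → Euc n)
    (σ : Euc n → Measure (Euc n) → Euc m → Measure (Euc m) → Matrix (Fin n) (Fin d1) ℝ)
    (μs : ℝ → Measure (Euc n))
    (Pm : Measure (Euc (d1 + d2) × Euc m × Measure (Euc m) × ℝ)),
    Measurable (fun q : Euc n × Measure (Euc n) => bbar q.1 q.2) ∧
    (∀ i j, Measurable (fun q : (Euc n × Measure (Euc n)) × Euc m × Measure (Euc m) =>
      σ q.1.1 q.1.2 q.2.1 q.2.2 i j)) ∧
    (∀ (z : Euc n) (μ : Measure (Euc n)),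
      ‖bbar z μ‖ ^ 2 ≤ B * (1 + ‖z‖ ^ 2 + ∫ w, ‖w‖ ^ 2 ∂μ)) ∧
    (∀ (z : Euc n) (μ : Measure (Euc n)) (y : Euc m) (ρ : Measure (Euc m)),
      hsNorm (σ z μ y ρ) ^ 2 ≤
        B * (1 + ‖z‖ ^ 2 + (∫ w, ‖w‖ ^ 2 ∂μ) + ‖y‖ ^ 2 + ∫ w, ‖w‖ ^ 2 ∂ρ)) ∧
    (∀ s ∈ Set.Icc (0 : ℝ) T, IsProbabilityMeasure (μs s) ∧
      Integrable (fun w => ‖w‖ ^ 2) (μs s) ∧ (∫ w, ‖w‖ ^ 2 ∂μs s) ≤ B) ∧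
    Pm.map (fun p => p.2.2.2) = (volume : Measure ℝ).restrict (Set.Icc 0 T) ∧
    (∀ᵐ p ∂Pm, IsProbabilityMeasure p.2.2.1) ∧
    (∫⁻ p, ((‖p.1‖₊ : ℝ≥0∞) ^ 2 + (‖p.2.1‖₊ : ℝ≥0∞) ^ 4 +
        ∫⁻ w, (‖w‖₊ : ℝ≥0∞) ^ 4 ∂p.2.2.1) ∂Pm) ≤ ENNReal.ofReal K ∧
    ContinuousOn φ (Set.Icc 0 T) ∧
    ∀ t ∈ Set.Icc (0 : ℝ) T,
      φ t = x + ∫ p in {p : Euc (d1 + d2) × Euc m × Measure (Euc m) × ℝ | p.2.2.2 ≤ t},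
        (bbar (φ p.2.2.2) (μs p.2.2.2) +
          (WithLp.equiv 2 (Fin n → ℝ)).symm
            ((σ (φ p.2.2.2) (μs p.2.2.2) p.2.1 p.2.2.1).mulVec
              (fun i : Fin d1 => p.1 (Fin.castAdd d2 i)))) ∂Pm

open Set Filter Topology

lemma norm_toLp_mulVec_le_hsNorm_mul {k l : ℕ} (A : Matrix (Fin k) (Fin l) ℝ) (v : Fin l → ℝ)
    {a : ℝ} (ha : 0 ≤ a) (hv : ∑ j, v j ^ 2 ≤ a ^ 2) :
    ‖(WithLp.equiv 2 (Fin k → ℝ)).symm (A.mulVec v)‖ ≤ hsNorm A * a := by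
  have hA : 0 ≤ hsNorm A := Real.sqrt_nonneg _
  refine abs_le_of_sq_le_sq' ?_ (mul_nonneg hA ha) |>.2
  have hA2 : hsNorm A ^ 2 = ∑ i, ∑ j, A i j ^ 2 :=
    Real.sq_sqrt (Finset.sum_nonneg fun i _ => Finset.sum_nonneg fun j _ => sq_nonneg _)
  rw [EuclideanSpace.real_norm_sq_eq, mul_pow, hA2, Finset.sum_mul]
  refine Finset.sum_le_sum fun i _ => ?_
  change (A.mulVec v i) ^ 2 ≤ _
  calc (A.mulVec v i) ^ 2 ≤ (∑ j, A i j ^ 2) * ∑ j, v j ^ 2 :=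
        Finset.sum_mul_sq_le_sq_mul_sq Finset.univ (A i) v
    _ ≤ _ := mul_le_mul_of_nonneg_left hv (Finset.sum_nonneg fun j _ => sq_nonneg _)

lemma sum_castAdd_sq_le_norm_sq {d1 d2 : ℕ} (h : Euc (d1 + d2)) :
    ∑ i : Fin d1, h (Fin.castAdd d2 i) ^ 2 ≤ ‖h‖ ^ 2 := by
  rw [EuclideanSpace.real_norm_sq_eq, Fin.sum_univ_add]
  exact le_add_of_nonneg_right (Finset.sum_nonneg fun i _ => sq_nonneg _)

lemma sq_integral_norm_sq_le {m : ℕ} (ρ : Measure (Euc m)) [IsProbabilityMeasure ρ]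
    (hρ : ∫⁻ w, (‖w‖₊ : ℝ≥0∞) ^ 4 ∂ρ ≠ ∞) :
    (∫ w, ‖w‖ ^ 2 ∂ρ) ^ 2 ≤ (∫⁻ w, (‖w‖₊ : ℝ≥0∞) ^ 4 ∂ρ).toReal := by
  have h4 : ∫ w, ‖w‖ ^ 4 ∂ρ = (∫⁻ w, (‖w‖₊ : ℝ≥0∞) ^ 4 ∂ρ).toReal := by
    rw [integral_eq_lintegral_of_nonneg_ae (ae_of_all _ fun w => by positivity)
      (by fun_prop)]
    congr 1
    refine lintegral_congr fun w => ?_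
    rw [ENNReal.ofReal_pow (norm_nonneg _), ofReal_norm]
    rfl
  have hi4 : Integrable (fun w : Euc m => ‖w‖ ^ 4) ρ := by
    refine ⟨by fun_prop, ?_⟩
    rw [hasFiniteIntegral_iff_enorm]
    refine lt_of_le_of_lt (le_of_eq (lintegral_congr fun w => ?_)) hρ.lt_top
    rw [enorm_pow, enorm_norm]
    rfl
  rw [← h4]
  set q := ∫ w, ‖w‖ ^ 2 ∂ρ with hq
  by_cases hi2 : Integrable (fun w : Euc m => ‖w‖ ^ 2) ρ
  · have : ∫ w, (2 * q * ‖w‖ ^ 2) ∂ρ ≤ ∫ w, (q ^ 2 + ‖w‖ ^ 4) ∂ρ := by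
      refine integral_mono (hi2.const_mul _) ((integrable_const _).add hi4) fun w => ?_
      change 2 * q * ‖w‖ ^ 2 ≤ q ^ 2 + ‖w‖ ^ 4
      nlinarith [sq_nonneg (q - ‖w‖ ^ 2)]
    rw [integral_const_mul, integral_add (integrable_const _) hi4, ← hq] at this
    simp only [integral_const, probReal_univ, one_smul] at this
    nlinarith
  · rw [hq, integral_undef hi2]
    simpa using integral_nonneg fun w : Euc m => by positivity

lemma drift_add_diffusion_le {B R b g a y q m4 e : ℝ} (hB : 0 < B) (hR : 0 ≤ R)
    (ha : 0 ≤ a) (hq : 0 ≤ q) (he : 0 < e)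
    (hb2 : b ^ 2 ≤ B * (1 + R ^ 2 + B)) (hg2 : g ^ 2 ≤ B * (1 + R ^ 2 + B + y ^ 2 + q))
    (hm : q ^ 2 ≤ m4) :
    b + g * a ≤ (1 + B) * ((1 + R) * (1 + 1 / e ^ 2) + 1 / e ^ 3) +
      (1 + B) * ((1 + R) * e ^ 2 + 2 * e) * (a ^ 2 + y ^ 4 + m4) := by
  obtain ⟨u, hu, hu2⟩ : ∃ u : ℝ, 0 ≤ u ∧ u ^ 2 = y ^ 2 + q :=
    ⟨√(y ^ 2 + q), Real.sqrt_nonneg _, Real.sq_sqrt (by positivity)⟩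
  have hu4 : u ^ 4 ≤ 2 * (y ^ 4 + m4) := by
    have : u ^ 4 = (y ^ 2 + q) ^ 2 := by rw [← hu2]; ring
    nlinarith [sq_nonneg (y ^ 2 - q)]
  have hb : b ≤ (1 + B) * (1 + R) := by
    refine (abs_le_of_sq_le_sq' (hb2.trans ?_) (by positivity)).2
    have h1 : (1 + R ^ 2 + B) ≤ (1 + B) * (1 + R) ^ 2 := by
      nlinarith [mul_nonneg hB.le hR, mul_nonneg hB.le (sq_nonneg R)]
    have h2 : B * ((1 + B) * (1 + R) ^ 2) ≤ (1 + B) * ((1 + B) * (1 + R) ^ 2) :=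
      mul_le_mul_of_nonneg_right (by linarith) (by positivity)
    nlinarith
  have hg : g ≤ (1 + B) * (1 + R + u) := by
    refine (abs_le_of_sq_le_sq' (hg2.trans ?_) (by positivity)).2
    have h1 : 1 + R ^ 2 + B + y ^ 2 + q ≤ (1 + B) * (1 + R + u) ^ 2 := by
      have : 1 + R ^ 2 + u ^ 2 ≤ (1 + R + u) ^ 2 := by
        nlinarith [mul_nonneg hR hu]
      have h3 : 1 ≤ (1 + R + u) ^ 2 := by nlinarith [mul_nonneg hR hu]
      nlinarith
    have h2 : B * ((1 + B) * (1 + R + u) ^ 2) ≤ (1 + B) * ((1 + B) * (1 + R + u) ^ 2) :=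
      mul_le_mul_of_nonneg_right (by linarith) (by positivity)
    nlinarith
  have hY1 : a ≤ e ^ 2 * a ^ 2 + 1 / e ^ 2 := by
    have hx : e * (1 / e) = 1 := by field_simp
    have : 1 / e ^ 2 = (1 / e) ^ 2 := by field_simp
    rw [this]
    nlinarith [sq_nonneg (e * a - 1 / e)]
  have hY2 : u * a ≤ e * a ^ 2 + e * u ^ 4 + 1 / e ^ 3 := by
    have h1 : 1 / e ^ 3 + e * u ^ 4 - u ^ 2 / e = ((1 / e ^ 2 - u ^ 2 / 2) ^ 2 + 3 / 4 * u ^ 4) * e := by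
      field_simp
      ring
    have h2 : e * a ^ 2 + u ^ 2 / e - u * a = ((e * a - u / 2) ^ 2 + 3 / 4 * u ^ 2) / e := by
      field_simp
      ring
    have h3 : 0 ≤ 1 / e ^ 3 + e * u ^ 4 - u ^ 2 / e := by rw [h1]; positivity
    have h4 : 0 ≤ e * a ^ 2 + u ^ 2 / e - u * a := by rw [h2]; positivity
    linarith
  have hm0 : 0 ≤ m4 := (sq_nonneg q).trans hm
  calc b + g * a ≤ (1 + B) * (1 + R) + (1 + B) * (1 + R + u) * a := by gcongr
    _ = (1 + B) * ((1 + R) + (1 + R) * a + u * a) := by ring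
    _ ≤ (1 + B) * ((1 + R) + (1 + R) * (e ^ 2 * a ^ 2 + 1 / e ^ 2) +
          (e * a ^ 2 + e * (2 * (y ^ 4 + m4)) + 1 / e ^ 3)) := by
        have : e * u ^ 4 ≤ e * (2 * (y ^ 4 + m4)) := by gcongr
        gcongr
        linarith
    _ ≤ (1 + B) * ((1 + R) + (1 + R) * (e ^ 2 * (a ^ 2 + y ^ 4 + m4) + 1 / e ^ 2) +
          (2 * e * (a ^ 2 + y ^ 4 + m4) + 1 / e ^ 3)) := by
        gcongr
        · nlinarith [sq_nonneg (y ^ 2)]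
        · nlinarith [mul_nonneg he.le (sq_nonneg a)]
    _ = _ := by ring

lemma ViablePath.continuousOn {n m d1 d2 : ℕ} {T B K : ℝ} {x : Euc n} {φ : ℝ → Euc n}
    (h : ViablePath n m d1 d2 T B K x φ) : ContinuousOn φ (Icc 0 T) := by
  obtain ⟨_, _, _, _, _, _, _, _, _, _, _, _, h, _⟩ := h
  exact h

lemma ViablePath.apply_zero {n m d1 d2 : ℕ} {T B K : ℝ} {x : Euc n} {φ : ℝ → Euc n}
    (hT : 0 < T) (h : ViablePath n m d1 d2 T B K x φ) : φ 0 = x := by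
  obtain ⟨bbar, σ, μs, Pm, -, -, -, -, -, hmap, -, -, -, heq⟩ := h
  rw [heq 0 ⟨le_rfl, hT.le⟩, setIntegral_measure_zero, add_zero]
  have : Pm.map (fun p => p.2.2.2) (Iic 0) = 0 := by
    rw [hmap, Measure.restrict_apply measurableSet_Iic]
    refine measure_mono_null (t := {0}) (fun s hs => ?_) (by simp)
    exact le_antisymm hs.1 hs.2.1
  rwa [Measure.map_apply (by fun_prop) measurableSet_Iic] at this

lemma norm_sub_le_of_dichotomy {E : Type*} [NormedAddCommGroup E] {φ : ℝ → E} {x : E}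
    {t1 t2 W : ℝ} (h12 : t1 ≤ t2) (hW : 0 ≤ W) (hc : ContinuousOn φ (Icc t1 t2))
    (h : ∀ t ∈ Icc t1 t2, ‖φ t - φ t1‖ ≤ W ∨ φ t = x) : ‖φ t2 - φ t1‖ ≤ W := by
  by_contra! hlt
  have hx : φ t2 = x := (h t2 ⟨h12, le_rfl⟩).resolve_left (not_le.2 hlt)
  have hg : ContinuousOn (fun t => ‖φ t - φ t1‖) (Icc t1 t2) :=
    (hc.sub continuousOn_const).norm
  obtain ⟨c, hc1, hc2⟩ := exists_between hlt
  obtain ⟨t, ht, hgt⟩ := intermediate_value_Icc h12 hg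
    (show c ∈ Icc ‖φ t1 - φ t1‖ ‖φ t2 - φ t1‖ by
      rw [sub_self, norm_zero]; exact ⟨hW.trans hc1.le, hc2.le⟩)
  rcases h t ht with h' | h'
  · exact absurd (hgt ▸ h') (not_le.2 hc1)
  · simp only [h', ← hx] at hgt
    exact hc2.ne' hgt

lemma ViablePath.norm_sub_le {n m d1 d2 : ℕ} {T B K : ℝ} {x : Euc n} {φ : ℝ → Euc n}
    (hB : 0 < B) (hK : 0 < K) (h : ViablePath n m d1 d2 T B K x φ)
    {t1 t2 R e : ℝ} (h1 : 0 ≤ t1) (h12 : t1 ≤ t2) (h2 : t2 ≤ T) (hR : 0 ≤ R)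
    (hφR : ∀ s ∈ Icc t1 t2, ‖φ s‖ ≤ R) (he : 0 < e) (hte : t2 - t1 ≤ e ^ 4) :
    ‖φ t2 - φ t1‖ ≤ (1 + B) * (1 + 2 * K) * ((1 + R) * (e ^ 4 + e ^ 2) + e) := by
  obtain ⟨bbar, σ, μs, Pm, -, -, hb, hσ, hμ, hmap, hprob, hmom, hcont, heq⟩ := h
  set W := (1 + B) * (1 + 2 * K) * ((1 + R) * (e ^ 4 + e ^ 2) + e) with hWdef
  have hW : 0 ≤ W := by positivity
  refine norm_sub_le_of_dichotomy (x := x) h12 hW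
    (hcont.mono (Icc_subset_Icc h1 h2)) fun t ht => ?_
  set F : Euc (d1 + d2) × Euc m × Measure (Euc m) × ℝ → Euc n := fun p =>
    bbar (φ p.2.2.2) (μs p.2.2.2) +
      (WithLp.equiv 2 (Fin n → ℝ)).symm
        ((σ (φ p.2.2.2) (μs p.2.2.2) p.2.1 p.2.2.1).mulVec
          (fun i : Fin d1 => p.1 (Fin.castAdd d2 i))) with hF
  set A : ℝ → Set (Euc (d1 + d2) × Euc m × Measure (Euc m) × ℝ) :=
    fun r => {p | p.2.2.2 ≤ r} with hA
  have hAm : ∀ r, MeasurableSet (A r) := fun r =>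
    measurableSet_le (by fun_prop) measurable_const
  have hφt := heq t ⟨h1.trans ht.1, ht.2.trans h2⟩
  by_cases hi : IntegrableOn F (A t) Pm
  swap
  · right
    rw [hφt, show (∫ p in A t, F p ∂Pm) = 0 from integral_undef hi, add_zero]
  left
  have hsub : A t1 ⊆ A t := fun p hp => le_trans hp ht.1
  have hdiff : φ t - φ t1 = ∫ p in A t \ A t1, F p ∂Pm := by
    rw [hφt, heq t1 ⟨h1, h12.trans h2⟩, add_sub_add_left_eq_sub]
    exact (setIntegral_sdiff (hAm t1) hi hsub).symm
  set c1 := (1 + B) * ((1 + R) * (1 + 1 / e ^ 2) + 1 / e ^ 3) with hc1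
  set c2 := (1 + B) * ((1 + R) * e ^ 2 + 2 * e) with hc2
  have hc1' : 0 ≤ c1 := by positivity
  have hc2' : 0 < c2 := by positivity
  set G : Euc (d1 + d2) × Euc m × Measure (Euc m) × ℝ → ℝ≥0∞ := fun p =>
    (‖p.1‖₊ : ℝ≥0∞) ^ 2 + (‖p.2.1‖₊ : ℝ≥0∞) ^ 4 + ∫⁻ w, (‖w‖₊ : ℝ≥0∞) ^ 4 ∂p.2.2.1 with hG
  have hpt : ∀ᵐ p ∂Pm.restrict (A t \ A t1),
      ‖F p‖ₑ ≤ ENNReal.ofReal c1 + ENNReal.ofReal c2 * G p := by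
    rw [ae_restrict_iff' ((hAm t).diff (hAm t1))]
    filter_upwards [hprob] with p hp hpA
    obtain ⟨hy, y, ρ, s⟩ := p
    simp only [hA, Set.mem_sdiff, mem_ofPred_eq, not_le] at hpA hp
    by_cases hρ : ∫⁻ w, (‖w‖₊ : ℝ≥0∞) ^ 4 ∂ρ = ∞
    · simp [hG, hρ, ENNReal.mul_top, hc2']
    have hsR : ‖φ s‖ ≤ R := hφR s ⟨hpA.2.le, hpA.1.trans ht.2⟩
    obtain ⟨-, -, hM⟩ := hμ s ⟨h1.trans hpA.2.le, (hpA.1.trans ht.2).trans h2⟩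
    have hsR2 : ‖φ s‖ ^ 2 ≤ R ^ 2 := by gcongr
    have key := drift_add_diffusion_le (b := ‖bbar (φ s) (μs s)‖)
      (g := hsNorm (σ (φ s) (μs s) y ρ)) (y := ‖y‖) hB hR (norm_nonneg hy)
      (integral_nonneg fun w => by positivity : (0 : ℝ) ≤ ∫ w, ‖w‖ ^ 2 ∂ρ) he
      ((hb _ _).trans (by gcongr)) ((hσ _ _ _ _).trans (by gcongr))
      (sq_integral_norm_sq_le ρ hρ)
    have hn : ‖F (hy, y, ρ, s)‖ ≤ c1 + c2 * (‖hy‖ ^ 2 + ‖y‖ ^ 4 +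
        (∫⁻ w, (‖w‖₊ : ℝ≥0∞) ^ 4 ∂ρ).toReal) :=
      (norm_add_le _ _).trans (le_trans (add_le_add_right
        (norm_toLp_mulVec_le_hsNorm_mul _ _ (norm_nonneg hy)
          (sum_castAdd_sq_le_norm_sq hy)) _) key)
    rw [← ofReal_norm]
    refine (ENNReal.ofReal_le_ofReal hn).trans (le_of_eq ?_)
    rw [ENNReal.ofReal_add hc1' (by positivity), ENNReal.ofReal_mul hc2'.le,
      ENNReal.ofReal_add (by positivity) ENNReal.toReal_nonneg,
      ENNReal.ofReal_add (by positivity) (by positivity), ENNReal.ofReal_toReal hρ,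
      ENNReal.ofReal_pow (norm_nonneg _), ENNReal.ofReal_pow (norm_nonneg _),
      ofReal_norm, ofReal_norm]
    rfl
  have hmeas : Pm (A t \ A t1) ≤ ENNReal.ofReal (e ^ 4) := by
    have hpre : A t \ A t1 = (fun p => p.2.2.2) ⁻¹' Ioc t1 t := by
      ext p
      simp only [hA, Set.mem_sdiff, mem_ofPred_eq, not_le, mem_preimage, mem_Ioc]
      exact and_comm
    rw [hpre, ← Measure.map_apply (by fun_prop) measurableSet_Ioc, hmap]
    refine (Measure.restrict_apply_le _ _).trans ?_
    rw [Real.volume_Ioc]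
    exact ENNReal.ofReal_le_ofReal (by linarith [ht.2])
  have hfin : ‖φ t - φ t1‖ₑ ≤ ENNReal.ofReal W := by
    rw [hdiff]
    calc ‖∫ p in A t \ A t1, F p ∂Pm‖ₑ ≤ ∫⁻ p in A t \ A t1, ‖F p‖ₑ ∂Pm :=
          enorm_integral_le_lintegral_enorm _
      _ ≤ ∫⁻ p in A t \ A t1, (ENNReal.ofReal c1 + ENNReal.ofReal c2 * G p) ∂Pm :=
          lintegral_mono_ae hpt
      _ = ENNReal.ofReal c1 * Pm (A t \ A t1) +
            ENNReal.ofReal c2 * ∫⁻ p in A t \ A t1, G p ∂Pm := by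
          rw [lintegral_add_left measurable_const, setLIntegral_const,
            lintegral_const_mul' _ _ ENNReal.ofReal_ne_top]
      _ ≤ ENNReal.ofReal c1 * ENNReal.ofReal (e ^ 4) +
            ENNReal.ofReal c2 * ENNReal.ofReal K := by
          gcongr
          exact (setLIntegral_le_lintegral _ _).trans hmom
      _ = ENNReal.ofReal (c1 * e ^ 4 + c2 * K) := by
          rw [ENNReal.ofReal_add (by positivity) (by positivity), ENNReal.ofReal_mul hc1',
            ENNReal.ofReal_mul hc2'.le]
      _ ≤ ENNReal.ofReal W := by
          refine ENNReal.ofReal_le_ofReal ?_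
          have : c1 * e ^ 4 = (1 + B) * ((1 + R) * (e ^ 4 + e ^ 2) + e) := by
            rw [hc1]; field_simp
          rw [this, hWdef, hc2]
          have h5 : ((1 + R) * e ^ 2 + 2 * e) * K ≤
              2 * K * ((1 + R) * (e ^ 4 + e ^ 2) + e) := by
            have : 0 ≤ K * ((1 + R) * e ^ 2) := by positivity
            have : 0 ≤ K * ((1 + R) * e ^ 4) := by positivity
            nlinarith
          have := mul_le_mul_of_nonneg_left h5 (by positivity : 0 ≤ 1 + B)
          nlinarith
  rwa [← ofReal_norm, ENNReal.ofReal_le_ofReal_iff hW] at hfin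

lemma exists_forall_viablePath_norm_le (n m d1 d2 : ℕ) {T B K : ℝ} (hT : 0 < T)
    (hB : 0 < B) (hK : 0 < K) (x : Euc n) :
    ∃ R, 0 ≤ R ∧ ∀ φ : ℝ → Euc n, ViablePath n m d1 d2 T B K x φ →
      ∀ t ∈ Icc (0 : ℝ) T, ‖φ t‖ ≤ R := by
  set M := (1 + B) * (1 + 2 * K) with hM
  have hM1 : 1 ≤ M := by nlinarith [mul_pos hB hK]
  have hM0 : 0 < M := by linarith
  set e := 1 / (2 * M) with he
  have he0 : 0 < e := by positivity
  have hMe : M * e = 1 / 2 := by rw [he]; field_simp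
  have hsmall : M * (e ^ 4 + e ^ 2) ≤ 1 / 2 := by
    have h1 : e ≤ 1 / 2 := by nlinarith
    have h2 : e ^ 4 + e ^ 2 = e * (e ^ 3 + e) := by ring
    have h3 : e ^ 3 ≤ 1 / 2 := by
      have : e ^ 3 ≤ (1 / 2 : ℝ) ^ 3 := by gcongr
      linarith
    rw [h2, ← mul_assoc, hMe]
    linarith
  have main : ∀ k : ℕ, ∃ R, 0 ≤ R ∧ ∀ φ : ℝ → Euc n, ViablePath n m d1 d2 T B K x φ →
      ∀ t ∈ Icc (0 : ℝ) T, t ≤ k * e ^ 4 → ‖φ t‖ ≤ R := by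
    intro k
    induction k with
    | zero =>
      refine ⟨‖x‖, norm_nonneg _, fun φ hφ t ht htk => ?_⟩
      have : t = 0 := le_antisymm (by simpa using htk) ht.1
      rw [this, hφ.apply_zero hT]
    | succ k ih =>
      obtain ⟨R, hR, hk⟩ := ih
      refine ⟨2 * R + 2, by positivity, fun φ hφ t ht htk => ?_⟩
      push_cast at htk
      obtain ⟨s, hs, hmax⟩ := isCompact_Icc.exists_isMaxOn (nonempty_Icc.2 ht.1)
        (hφ.continuousOn.mono (Icc_subset_Icc_right ht.2)).norm
      have hts : ‖φ t‖ ≤ ‖φ s‖ := hmax ⟨ht.1, le_rfl⟩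
      rcases le_total s (k * e ^ 4) with hsk | hsk
      · linarith [hk φ hφ s ⟨hs.1, hs.2.trans ht.2⟩ hsk]
      · have hk0 : 0 ≤ (k : ℝ) * e ^ 4 := by positivity
        have hstep := hφ.norm_sub_le hB hK hk0 hsk (hs.2.trans ht.2) (norm_nonneg (φ s))
          (fun r hr => hmax ⟨hk0.trans hr.1, hr.2.trans hs.2⟩) he0
          (by linarith [hs.2])
        rw [← hM] at hstep
        have hRk := hk φ hφ (k * e ^ 4) ⟨hk0, hsk.trans (hs.2.trans ht.2)⟩ le_rfl
        have htri : ‖φ s‖ ≤ ‖φ (k * e ^ 4)‖ + ‖φ s - φ (k * e ^ 4)‖ :=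
          norm_le_norm_add_norm_sub' _ _
        have hmul := mul_le_mul_of_nonneg_right hsmall
          (by positivity : 0 ≤ 1 + ‖φ s‖)
        have hexp : M * ((1 + ‖φ s‖) * (e ^ 4 + e ^ 2) + e) =
            M * (e ^ 4 + e ^ 2) * (1 + ‖φ s‖) + M * e := by ring
        rw [hexp, hMe] at hstep
        linarith
  obtain ⟨N, hN⟩ := exists_nat_ge (T / e ^ 4)
  obtain ⟨R, hR, h⟩ := main N
  refine ⟨R, hR, fun φ hφ t ht => h φ hφ t ht (ht.2.trans ?_)⟩
  rwa [div_le_iff₀ (by positivity)] at hN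

lemma isCompact_closure_of_bounded_of_modulus {X E : Type*} [PseudoMetricSpace X]
    [CompactSpace X] [NormedAddCommGroup E] [ProperSpace E] {S : Set C(X, E)} {R : ℝ}
    {b : ℝ → ℝ} (hb : Tendsto b (𝓝 0) (𝓝 0)) (hR : ∀ ψ ∈ S, ∀ t, ‖ψ t‖ ≤ R)
    (hS : ∀ ψ ∈ S, ∀ s t, dist (ψ s) (ψ t) ≤ b (dist s t)) : IsCompact (closure S) := by
  let L := (ContinuousMap.isometryEquivBoundedOfCompact X E).toHomeomorph
  have h : IsCompact (closure (L '' S)) := by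
    refine BoundedContinuousFunction.arzela_ascoli (Metric.closedBall 0 R)
      (isCompact_closedBall 0 R) _ ?_ ?_
    · rintro _ t ⟨ψ, hψ, rfl⟩
      exact mem_closedBall_zero_iff.2 (hR ψ hψ t)
    · refine Metric.equicontinuous_of_continuity_modulus b hb _ ?_
      rintro s t ⟨_, ψ, hψ, rfl⟩
      exact hS ψ hψ s t
  rwa [← L.image_closure, L.isCompact_image] at h

/-- uniform `(1/2, 1/4)`-Hölder continuity of viable paths, with a constant
depending only on `n, B, K, T` and `|x|`; in particular the collection of all viable paths
is relatively compact in `C([0,T]; ℝⁿ)`. -/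
theorem viablePath_holder_and_compact (n m d1 d2 : ℕ) (T B K : ℝ) (hT : 0 < T)
    (hB : 0 < B) (hK : 0 < K) (x : Euc n) :
    ∃ C > 0,
      (∀ φ : ℝ → Euc n, ViablePath n m d1 d2 T B K x φ →
        ∀ t1 t2 : ℝ, t1 ∈ Set.Icc (0 : ℝ) T → t2 ∈ Set.Icc (0 : ℝ) T → t1 ≤ t2 →
          ‖φ t2 - φ t1‖ ≤ C * ((t2 - t1) ^ (1 / 2 : ℝ) + (t2 - t1) ^ (1 / 4 : ℝ))) ∧
      IsCompact (closure {ψ : C(Set.Icc (0 : ℝ) T, Euc n) |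
        ∃ φ : ℝ → Euc n, ViablePath n m d1 d2 T B K x φ ∧
          ∀ t : Set.Icc (0 : ℝ) T, ψ t = φ t.1}) := by
  obtain ⟨R, hR, hbound⟩ := exists_forall_viablePath_norm_le n m d1 d2 hT hB hK x
  set C := (1 + B) * (1 + 2 * K) * ((1 + R) * (√T + 1) + 1) with hC
  have hC0 : 0 < C := by positivity
  have hold : ∀ φ : ℝ → Euc n, ViablePath n m d1 d2 T B K x φ →
      ∀ t1 t2 : ℝ, t1 ∈ Set.Icc (0 : ℝ) T → t2 ∈ Set.Icc (0 : ℝ) T → t1 ≤ t2 →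
        ‖φ t2 - φ t1‖ ≤ C * ((t2 - t1) ^ (1 / 2 : ℝ) + (t2 - t1) ^ (1 / 4 : ℝ)) := by
    intro φ hφ t1 t2 ht1 ht2 h12
    rcases h12.eq_or_lt with rfl | hlt
    · rw [sub_self, norm_zero, sub_self]
      positivity
    have hδ : 0 < t2 - t1 := sub_pos.2 hlt
    set e := (t2 - t1) ^ (1 / 4 : ℝ) with he
    have he0 : 0 < e := Real.rpow_pos_of_pos hδ _
    have he2 : (t2 - t1) ^ (1 / 2 : ℝ) = e ^ 2 := by
      rw [he, ← Real.rpow_natCast, ← Real.rpow_mul hδ.le]; norm_num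
    have he4 : t2 - t1 = e ^ 4 := by
      rw [he, ← Real.rpow_natCast, ← Real.rpow_mul hδ.le]; norm_num
    have heT : e ^ 2 ≤ √T :=
      Real.le_sqrt_of_sq_le (by linarith [ht1.1, ht2.2, show (e ^ 2) ^ 2 = e ^ 4 by ring])
    refine (hφ.norm_sub_le hB hK ht1.1 h12 ht2.2 hR
      (fun s hs => hbound φ hφ s ⟨ht1.1.trans hs.1, hs.2.trans ht2.2⟩) he0 he4.le).trans ?_
    rw [he2, hC, mul_assoc _ _ (e ^ 2 + e)]
    refine mul_le_mul_of_nonneg_left ?_ (by positivity)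
    have h4 : e ^ 4 ≤ √T * e ^ 2 := by
      rw [show e ^ 4 = e ^ 2 * e ^ 2 by ring]; gcongr
    calc (1 + R) * (e ^ 4 + e ^ 2) + e ≤ (1 + R) * (√T * e ^ 2 + e ^ 2) + e := by gcongr
      _ ≤ (1 + R) * (√T * e ^ 2 + e ^ 2) + e + ((1 + R) * (√T + 1) * e + e ^ 2) :=
          le_add_of_nonneg_right (by positivity)
      _ = _ := by ring
  refine ⟨C, hC0, hold, ?_⟩
  refine isCompact_closure_of_bounded_of_modulus (R := R)
    (b := fun r => C * (r ^ (1 / 2 : ℝ) + r ^ (1 / 4 : ℝ))) ?_ ?_ ?_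
  · have h : Continuous fun r : ℝ => C * (r ^ (1 / 2 : ℝ) + r ^ (1 / 4 : ℝ)) :=
      continuous_const.mul ((Real.continuous_rpow_const (by norm_num)).add
        (Real.continuous_rpow_const (by norm_num)))
    simpa using h.tendsto 0
  · rintro ψ ⟨φ, hφ, hψ⟩ t
    rw [hψ]
    exact hbound φ hφ t t.2
  · rintro ψ ⟨φ, hφ, hψ⟩ s t
    wlog hst : t ≤ s generalizing s t
    · rw [dist_comm, dist_comm s t]
      exact this t s (le_of_not_ge hst)
    rw [hψ, hψ, dist_eq_norm, Subtype.dist_eq, Real.dist_eq,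
      abs_of_nonneg (sub_nonneg.2 (show (t : ℝ) ≤ s from hst))]
    exact hold φ hφ t s t.2 s.2 hst
end
end
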